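/- arXiv:2310.07717 — 7 statements merged into one kernel-verified Lean document; each statement's English description precedes it below -/
import Mathlib

section
/- Let A₁, A₂, A₃ be pairwise distinct, non-collinear points in the Euclidean plane, let b₁, b₂, b₃ > 0, and for i ≠ j set U_{ij} = (A_j − A_i)/dist(A_i,A_j). Let A₀ be the unique global minimizer of f(P) = b₁·dist(P,A₁) + b₂·dist(P,A₂) + b₃·dist(P,A₃). Then the following are equivalent: (I) ‖b₂·U₁₂ + b₃·U₁₃‖ > b₁, ‖b₁·U₂₁ + b₃·U₂₃‖ > b₂, and ‖b₁·U₃₁ + b₂·U₃₂‖ > b₃; (II) A₀ ∉ {A₁, A₂, A₃} and A₀ does not lie on any of the closed segments [A₁,A₂], [A₂,A₃], [A₁,A₃]. -/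
/-- The unit vector from `A` toward `B` (for distinct points `A`, `B`). -/
noncomputable def unitDir (A B : EuclideanSpace ℝ (Fin 2)) : EuclideanSpace ℝ (Fin 2) :=
  (dist A B)⁻¹ • (B - A)

section FermatTorricelli

variable {E : Type*} [NormedAddCommGroup E] [InnerProductSpace ℝ E]

theorem nonpos_of_forall_pos_le_mul {a C : ℝ} (h : ∀ t : ℝ, 0 < t → a ≤ t * C) : a ≤ 0 := by
  by_contra! ha
  have hC : 0 < |C| + 1 := by positivity
  have h1 := h (a / (2 * (|C| + 1))) (by positivity)
  have h2 : a / (2 * (|C| + 1)) * C ≤ a / (2 * (|C| + 1)) * (|C| + 1) :=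
    mul_le_mul_of_nonneg_left (by linarith [le_abs_self C]) (by positivity)
  have h3 : a / (2 * (|C| + 1)) * (|C| + 1) = a / 2 := by field_simp
  linarith

/-- Second-order upper bound for the distance to `A` along a line through `Q ≠ A`. -/
theorem dist_add_smul_le {Q A : E} (h : Q ≠ A) (v : E) (t : ℝ) :
    dist (Q + t • v) A ≤ dist Q A - t * inner ℝ ((dist Q A)⁻¹ • (A - Q)) v
      + t ^ 2 * (‖v‖ ^ 2 / (2 * dist Q A)) := by
  have hd : 0 < dist Q A := dist_pos.2 h
  have hexp : dist (Q + t • v) A ^ 2 =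
      dist Q A ^ 2 - 2 * t * inner ℝ (A - Q) v + t ^ 2 * ‖v‖ ^ 2 := by
    rw [dist_comm, dist_comm Q A, dist_eq_norm, dist_eq_norm,
      show A - (Q + t • v) = (A - Q) - t • v by abel, norm_sub_sq_real, norm_smul,
      inner_smul_right, mul_pow, Real.norm_eq_abs, sq_abs]
    ring
  have key : dist (Q + t • v) A ≤ (dist (Q + t • v) A ^ 2 + dist Q A ^ 2) / (2 * dist Q A) := by
    rw [le_div_iff₀ (by positivity)]
    nlinarith [sq_nonneg (dist (Q + t • v) A - dist Q A)]
  refine key.trans (le_of_eq ?_)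
  rw [hexp, real_inner_smul_left]
  field_simp
  ring

theorem norm_inv_dist_smul_sub {Q A : E} (h : Q ≠ A) : ‖(dist Q A)⁻¹ • (A - Q)‖ = 1 := by
  have hd : 0 < dist Q A := dist_pos.2 h
  rw [norm_smul, ← dist_eq_norm, dist_comm A Q, norm_inv, Real.norm_of_nonneg hd.le,
    inv_mul_cancel₀ hd.ne']

theorem inner_inv_dist_smul_sub {Q A : E} (h : Q ≠ A) (P : E) :
    inner ℝ ((dist Q A)⁻¹ • (A - Q)) (A - P) =
      dist Q A - inner ℝ ((dist Q A)⁻¹ • (A - Q)) (P - Q) := by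
  have hd : 0 < dist Q A := dist_pos.2 h
  rw [show A - P = (A - Q) - (P - Q) by abel, inner_sub_right,
    real_inner_smul_left (A - Q) (A - Q), real_inner_self_eq_norm_sq, ← dist_eq_norm,
    dist_comm A Q, sq, inv_mul_cancel_left₀ hd.ne']

/-- Subgradient inequality for the distance to `A`, at a point `Q ≠ A`. -/
theorem dist_sub_inner_le_dist {Q A : E} (h : Q ≠ A) (P : E) :
    dist Q A - inner ℝ ((dist Q A)⁻¹ • (A - Q)) (P - Q) ≤ dist P A := by
  rw [← inner_inv_dist_smul_sub h]
  refine (real_inner_le_norm _ _).trans ?_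
  rw [norm_inv_dist_smul_sub h, one_mul, dist_comm P, dist_eq_norm]

/-- In the equality case of `dist_sub_inner_le_dist`, `P` lies on the line through `Q` and `A`. -/
theorem exists_sub_eq_smul_of_dist_eq {Q A P : E} (h : Q ≠ A)
    (heq : dist P A = dist Q A - inner ℝ ((dist Q A)⁻¹ • (A - Q)) (P - Q)) :
    ∃ r : ℝ, P - Q = r • (A - Q) := by
  have hn := norm_inv_dist_smul_sub h
  rw [← inner_inv_dist_smul_sub h, dist_comm P, dist_eq_norm] at heq
  have := (inner_eq_norm_mul_iff_real (x := (dist Q A)⁻¹ • (A - Q)) (y := A - P)).1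
    (by rw [hn, one_mul, heq])
  rw [hn, one_smul, smul_smul] at this
  refine ⟨1 - ‖A - P‖ * (dist Q A)⁻¹, ?_⟩
  rw [sub_smul, this, one_smul]
  abel

theorem norm_le_of_isMin_at_vertex {A B C : E} {a b c : ℝ} (hAB : A ≠ B) (hAC : A ≠ C)
    (ha : 0 ≤ a) (hb : 0 ≤ b) (hc : 0 ≤ c)
    (hmin : ∀ P, b * dist A B + c * dist A C ≤ a * dist P A + b * dist P B + c * dist P C) :
    ‖b • ((dist A B)⁻¹ • (B - A)) + c • ((dist A C)⁻¹ • (C - A))‖ ≤ a := by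
  set g := b • ((dist A B)⁻¹ • (B - A)) + c • ((dist A C)⁻¹ • (C - A)) with hg
  have hgg : ‖g‖ ^ 2 = b * inner ℝ ((dist A B)⁻¹ • (B - A)) g
      + c * inner ℝ ((dist A C)⁻¹ • (C - A)) g := by
    rw [← real_inner_smul_left, ← real_inner_smul_left, ← inner_add_left, ← hg,
      real_inner_self_eq_norm_sq]
  have key : ‖g‖ ^ 2 - a * ‖g‖ ≤ 0 := by
    refine nonpos_of_forall_pos_le_mul
      (C := b * (‖g‖ ^ 2 / (2 * dist A B)) + c * (‖g‖ ^ 2 / (2 * dist A C))) fun t ht => ?_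
    have hA : dist (A + t • g) A = t * ‖g‖ := by
      rw [dist_eq_norm, add_sub_cancel_left, norm_smul, Real.norm_of_nonneg ht.le]
    have h1 := mul_le_mul_of_nonneg_left (dist_add_smul_le hAB g t) hb
    have h2 := mul_le_mul_of_nonneg_left (dist_add_smul_le hAC g t) hc
    have h3 := hmin (A + t • g)
    rw [hA] at h3
    refine le_of_mul_le_mul_left ?_ ht
    linear_combination h1 + h2 + h3 + t * hgg
  by_contra! hlt
  nlinarith [mul_pos (ha.trans_lt hlt) (sub_pos.2 hlt)]

theorem sum_smul_eq_zero_of_isMin {Q A B C : E} {a b c : ℝ} (hA : Q ≠ A) (hB : Q ≠ B)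
    (hC : Q ≠ C) (ha : 0 ≤ a) (hb : 0 ≤ b) (hc : 0 ≤ c)
    (hmin : ∀ P, a * dist Q A + b * dist Q B + c * dist Q C ≤
      a * dist P A + b * dist P B + c * dist P C) :
    a • ((dist Q A)⁻¹ • (A - Q)) + b • ((dist Q B)⁻¹ • (B - Q))
      + c • ((dist Q C)⁻¹ • (C - Q)) = 0 := by
  set g := a • ((dist Q A)⁻¹ • (A - Q)) + b • ((dist Q B)⁻¹ • (B - Q))
      + c • ((dist Q C)⁻¹ • (C - Q)) with hg
  have hgg : ‖g‖ ^ 2 = a * inner ℝ ((dist Q A)⁻¹ • (A - Q)) g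
      + b * inner ℝ ((dist Q B)⁻¹ • (B - Q)) g + c * inner ℝ ((dist Q C)⁻¹ • (C - Q)) g := by
    rw [← real_inner_smul_left, ← real_inner_smul_left, ← real_inner_smul_left,
      ← inner_add_left, ← inner_add_left, ← hg, real_inner_self_eq_norm_sq]
  have key : ‖g‖ ^ 2 ≤ 0 := by
    refine nonpos_of_forall_pos_le_mul
      (C := a * (‖g‖ ^ 2 / (2 * dist Q A)) + b * (‖g‖ ^ 2 / (2 * dist Q B))
        + c * (‖g‖ ^ 2 / (2 * dist Q C))) fun t ht => ?_
    have h1 := mul_le_mul_of_nonneg_left (dist_add_smul_le hA g t) ha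
    have h2 := mul_le_mul_of_nonneg_left (dist_add_smul_le hB g t) hb
    have h3 := mul_le_mul_of_nonneg_left (dist_add_smul_le hC g t) hc
    have h4 := hmin (Q + t • g)
    refine le_of_mul_le_mul_left ?_ ht
    linear_combination h1 + h2 + h3 + h4 + t * hgg
  exact norm_eq_zero.1 (pow_eq_zero_iff two_ne_zero |>.1 (le_antisymm key (sq_nonneg _)))

theorem collinear_of_isMin_mem_segment {Q A B C : E} {a b c : ℝ} (hA : Q ≠ A) (hB : Q ≠ B)
    (hC : Q ≠ C) (ha : 0 ≤ a) (hb : 0 ≤ b) (hc : 0 < c)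
    (hmin : ∀ P, a * dist Q A + b * dist Q B + c * dist Q C ≤
      a * dist P A + b * dist P B + c * dist P C)
    (hQ : Q ∈ segment ℝ A B) : Collinear ℝ ({A, B, C} : Set E) := by
  have h0 := sum_smul_eq_zero_of_isMin hA hB hC ha hb hc.le hmin
  rw [segment_eq_image'] at hQ
  obtain ⟨s, -, hs⟩ := hQ
  have hs' : Q = A + s • (B - A) := hs.symm
  simp only [smul_smul] at h0
  set x := a * (dist Q A)⁻¹
  set y := b * (dist Q B)⁻¹
  have hz : c * (dist Q C)⁻¹ ≠ 0 := (mul_pos hc (inv_pos.2 (dist_pos.2 hC))).ne'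
  set z := c * (dist Q C)⁻¹
  clear_value x y z
  rw [collinear_iff_of_mem (p₀ := A) (by simp)]
  refine ⟨B - A, ?_⟩
  rintro p (rfl | rfl | rfl)
  · exact ⟨0, by simp⟩
  · exact ⟨1, by simp⟩
  · refine ⟨s + z⁻¹ * (x * s - y * (1 - s)), ?_⟩
    have h1 : z • (p - Q) = (x * s - y * (1 - s)) • (B - A) := by
      rw [← sub_eq_zero, ← h0, hs']
      module
    have h2 : p - Q = (z⁻¹ * (x * s - y * (1 - s))) • (B - A) := by
      rw [mul_smul, ← h1, inv_smul_smul₀ hz]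
    rw [add_smul, ← h2, hs', vadd_eq_add]
    abel

theorem collinear_of_norm_le {Q A B C : E} {a b c : ℝ} (hQ : Q ≠ A) (hAB : A ≠ B)
    (hAC : A ≠ C) (hb : 0 < b) (hc : 0 < c)
    (hnorm : ‖b • ((dist A B)⁻¹ • (B - A)) + c • ((dist A C)⁻¹ • (C - A))‖ ≤ a)
    (hle : a * dist Q A + b * dist Q B + c * dist Q C ≤ b * dist A B + c * dist A C) :
    Collinear ℝ ({A, B, C} : Set E) := by
  have h1 := dist_sub_inner_le_dist hAB Q
  have h2 := dist_sub_inner_le_dist hAC Q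
  have h3 := (real_inner_le_norm (b • ((dist A B)⁻¹ • (B - A)) + c • ((dist A C)⁻¹ • (C - A)))
    (Q - A)).trans (mul_le_mul_of_nonneg_right hnorm (norm_nonneg _))
  rw [inner_add_left, real_inner_smul_left _ _ b, real_inner_smul_left _ _ c,
    ← dist_eq_norm] at h3
  have e1 : dist Q B = dist A B - inner ℝ ((dist A B)⁻¹ • (B - A)) (Q - A) :=
    le_antisymm (le_of_mul_le_mul_left
      (by linarith [mul_le_mul_of_nonneg_left h2 hc.le]) hb) h1
  have e2 : dist Q C = dist A C - inner ℝ ((dist A C)⁻¹ • (C - A)) (Q - A) :=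
    le_antisymm (le_of_mul_le_mul_left
      (by linarith [mul_le_mul_of_nonneg_left h1 hb.le]) hc) h2
  obtain ⟨r, hr⟩ := exists_sub_eq_smul_of_dist_eq hAB e1
  obtain ⟨s, hs⟩ := exists_sub_eq_smul_of_dist_eq hAC e2
  have hr0 : r ≠ 0 := by
    rintro rfl
    exact hQ (sub_eq_zero.1 (by simpa using hr))
  have hs0 : s ≠ 0 := by
    rintro rfl
    exact hQ (sub_eq_zero.1 (by simpa using hs))
  rw [collinear_iff_of_mem (p₀ := A) (by simp)]
  refine ⟨Q - A, ?_⟩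
  rintro p (rfl | rfl | rfl)
  · exact ⟨0, by simp⟩
  · exact ⟨r⁻¹, by rw [hr, inv_smul_smul₀ hr0, vadd_eq_add, sub_add_cancel]⟩
  · exact ⟨s⁻¹, by rw [hs, inv_smul_smul₀ hs0, vadd_eq_add, sub_add_cancel]⟩

end FermatTorricelli

/-- **Characterization of the weighted Fermat–Torricelli solution** (Lemma 1 of the paper,
Euclidean-plane version).  Let `A₀` be the global minimizer of
`f P = b₁ * dist P A₁ + b₂ * dist P A₂ + b₃ * dist P A₃`.  Then the three norm
inequalities (I) hold simultaneously iff (II) `A₀` is distinct from `A₁, A₂, A₃` and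
does not lie on any of the segments `[A₁,A₂]`, `[A₂,A₃]`, `[A₁,A₃]`. -/
theorem fermat_torricelli_characterization
    (A₁ A₂ A₃ A₀ : EuclideanSpace ℝ (Fin 2))
    (h12 : A₁ ≠ A₂) (h13 : A₁ ≠ A₃) (h23 : A₂ ≠ A₃)
    (hncol : ¬ Collinear ℝ ({A₁, A₂, A₃} : Set (EuclideanSpace ℝ (Fin 2))))
    (b₁ b₂ b₃ : ℝ) (hb₁ : 0 < b₁) (hb₂ : 0 < b₂) (hb₃ : 0 < b₃)
    (hmin : ∀ P : EuclideanSpace ℝ (Fin 2),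
      b₁ * dist A₀ A₁ + b₂ * dist A₀ A₂ + b₃ * dist A₀ A₃ ≤
        b₁ * dist P A₁ + b₂ * dist P A₂ + b₃ * dist P A₃) :
    (b₁ < ‖b₂ • unitDir A₁ A₂ + b₃ • unitDir A₁ A₃‖ ∧
     b₂ < ‖b₁ • unitDir A₂ A₁ + b₃ • unitDir A₂ A₃‖ ∧
     b₃ < ‖b₁ • unitDir A₃ A₁ + b₂ • unitDir A₃ A₂‖) ↔
    (A₀ ≠ A₁ ∧ A₀ ≠ A₂ ∧ A₀ ≠ A₃ ∧
     A₀ ∉ segment ℝ A₁ A₂ ∧ A₀ ∉ segment ℝ A₂ A₃ ∧ A₀ ∉ segment ℝ A₁ A₃) := by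
  have hncol₂ : ¬ Collinear ℝ ({A₂, A₁, A₃} : Set (EuclideanSpace ℝ (Fin 2))) := by
    rwa [Set.insert_comm]
  have hncol₃ : ¬ Collinear ℝ ({A₃, A₁, A₂} : Set (EuclideanSpace ℝ (Fin 2))) := by
    rwa [Set.insert_comm, Set.pair_comm]
  constructor
  · rintro ⟨i₁, i₂, i₃⟩
    have n₁ : A₀ ≠ A₁ := by
      rintro rfl
      refine absurd i₁ (norm_le_of_isMin_at_vertex h12 h13 hb₁.le hb₂.le hb₃.le
        fun P => ?_).not_gt
      simpa using hmin P
    have n₂ : A₀ ≠ A₂ := by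
      rintro rfl
      refine absurd i₂ (norm_le_of_isMin_at_vertex h12.symm h23 hb₂.le hb₁.le hb₃.le
        fun P => ?_).not_gt
      have := hmin P
      rw [dist_self] at this
      linarith
    have n₃ : A₀ ≠ A₃ := by
      rintro rfl
      refine absurd i₃ (norm_le_of_isMin_at_vertex h13.symm h23.symm hb₃.le hb₁.le hb₂.le
        fun P => ?_).not_gt
      have := hmin P
      rw [dist_self] at this
      linarith
    refine ⟨n₁, n₂, n₃, fun hs => hncol ?_, fun hs => hncol₂ ?_, fun hs => hncol ?_⟩
    · exact collinear_of_isMin_mem_segment n₁ n₂ n₃ hb₁.le hb₂.le hb₃ hmin hs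
    · rw [Set.pair_comm]
      exact collinear_of_isMin_mem_segment n₂ n₃ n₁ hb₂.le hb₃.le hb₁
        (fun P => by linarith [hmin P]) hs
    · rw [Set.pair_comm]
      exact collinear_of_isMin_mem_segment n₁ n₃ n₂ hb₁.le hb₃.le hb₂
        (fun P => by linarith [hmin P]) hs
  · rintro ⟨n₁, n₂, n₃, -⟩
    refine ⟨?_, ?_, ?_⟩ <;> by_contra! hle
    · refine hncol (collinear_of_norm_le n₁ h12 h13 hb₂ hb₃ hle ?_)
      simpa using hmin A₁
    · refine hncol₂ (collinear_of_norm_le n₂ h12.symm h23 hb₁ hb₃ hle ?_)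
      have := hmin A₂
      rw [dist_self] at this
      linarith
    · refine hncol₃ (collinear_of_norm_le n₃ h13.symm h23.symm hb₁ hb₂ hle ?_)
      have := hmin A₃
      rw [dist_self] at this
      linarith
end

section
/- Let A₁, A₂, A₃ be pairwise distinct points in the Euclidean plane, let b₁, b₂, b₃ > 0, and let A₀ be a point with A₀ ∉ {A₁, A₂, A₃} such that b₁·(A₁ − A₀)/dist(A₀,A₁) + b₂·(A₂ − A₀)/dist(A₀,A₂) + b₃·(A₃ − A₀)/dist(A₀,A₃) = 0. Then A₀ is a global minimizer of f(P) = b₁·dist(P,A₁) + b₂·dist(P,A₂) + b₃·dist(P,A₃). -/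
/-- Subgradient inequality for the weighted distance `P ↦ b * dist P A` at the point `A₀`. -/
theorem mul_dist_sub_inner_le_mul_dist {E : Type*} [NormedAddCommGroup E] [InnerProductSpace ℝ E]
    {b : ℝ} (hb : 0 ≤ b) {A A₀ : E} (h : A₀ ≠ A) (P : E) :
    b * dist A₀ A - inner ℝ ((b / dist A₀ A) • (A - A₀)) (P - A₀) ≤ b * dist P A := by
  have hd : 0 < dist A₀ A := dist_pos.mpr h
  have hsplit : inner ℝ (A - A₀) (P - A₀) = dist A₀ A ^ 2 - inner ℝ (A - A₀) (A - P) := by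
    rw [dist_eq_norm', ← real_inner_self_eq_norm_sq, ← inner_sub_right, sub_sub_sub_cancel_left]
  have hcs : inner ℝ (A - A₀) (A - P) ≤ dist A₀ A * dist P A := by
    simpa only [dist_eq_norm'] using real_inner_le_norm (A - A₀) (A - P)
  calc b * dist A₀ A - inner ℝ ((b / dist A₀ A) • (A - A₀)) (P - A₀)
      = b / dist A₀ A * inner ℝ (A - A₀) (A - P) := by
        rw [real_inner_smul_left, hsplit]
        field_simp
        ring
    _ ≤ b / dist A₀ A * (dist A₀ A * dist P A) := by gcongr
    _ = b * dist P A := by field_simp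

/-- **Converse of the balancing condition**: if `A₀ ∉ {A₁, A₂, A₃}` satisfies the
weighted balancing condition for the unit vectors from `A₀` toward `A₁, A₂, A₃`, then
`A₀` is a global minimizer of
`f P = b₁ * dist P A₁ + b₂ * dist P A₂ + b₃ * dist P A₃`. -/
theorem fermat_torricelli_of_balancing
    (A₁ A₂ A₃ A₀ : EuclideanSpace ℝ (Fin 2))
    (h12 : A₁ ≠ A₂) (h13 : A₁ ≠ A₃) (h23 : A₂ ≠ A₃)
    (h01 : A₀ ≠ A₁) (h02 : A₀ ≠ A₂) (h03 : A₀ ≠ A₃)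
    (b₁ b₂ b₃ : ℝ) (hb₁ : 0 < b₁) (hb₂ : 0 < b₂) (hb₃ : 0 < b₃)
    (hbal : (b₁ / dist A₀ A₁) • (A₁ - A₀) + (b₂ / dist A₀ A₂) • (A₂ - A₀) +
      (b₃ / dist A₀ A₃) • (A₃ - A₀) = 0) :
    ∀ P : EuclideanSpace ℝ (Fin 2),
      b₁ * dist A₀ A₁ + b₂ * dist A₀ A₂ + b₃ * dist A₀ A₃ ≤
        b₁ * dist P A₁ + b₂ * dist P A₂ + b₃ * dist P A₃ := by
  intro P
  have hinner := congrArg (fun v => inner ℝ v (P - A₀)) hbal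
  simp only [inner_add_left, inner_zero_left] at hinner
  linarith [mul_dist_sub_inner_le_mul_dist hb₁.le h01 P,
    mul_dist_sub_inner_le_mul_dist hb₂.le h02 P, mul_dist_sub_inner_le_mul_dist hb₃.le h03 P]
end

section
/- Let u₁, u₂, u₃ be unit vectors in a real inner product space such that no two of them are parallel (u_i ≠ u_j and u_i ≠ −u_j for all i ≠ j), let b₁, b₂, b₃ > 0 satisfy b₁·u₁ + b₂·u₂ + b₃·u₃ = 0, and set C = b₁ + b₂ + b₃. Writing φ_{i0j} := arccos⟨u_i, u_j⟩, for every permutation (i, j, k) of (1, 2, 3) one has b_i = C/(1 + sin φ_{i0k}/sin φ_{j0k} + sin φ_{i0j}/sin φ_{j0k}); equivalently b_i = C·sin φ_{j0k}/(sin φ₁₀₂ + sin φ₂₀₃ + sin φ₃₀₁). -/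
open scoped RealInnerProductSpace

open Real in
/-- The sine rule for three unit vectors in equilibrium (Lami's theorem). -/
theorem mul_sin_arccos_inner_eq_of_balanced
    {E : Type*} [NormedAddCommGroup E] [InnerProductSpace ℝ E] {x y z : E}
    (hx : ‖x‖ = 1) (hy : ‖y‖ = 1) (hz : ‖z‖ = 1) {a b c : ℝ} (ha : 0 ≤ a) (hc : 0 ≤ c)
    (h : a • x + b • y + c • z = 0) :
    a * sin (arccos ⟪x, y⟫) = c * sin (arccos ⟪y, z⟫) := by
  have h1 : a + b * ⟪x, y⟫ + c * ⟪x, z⟫ = 0 := by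
    simpa [inner_add_right, inner_smul_right, hx] using congrArg (fun v => ⟪x, v⟫) h
  have h2 : a * ⟪x, y⟫ + b + c * ⟪y, z⟫ = 0 := by
    simpa [inner_add_right, inner_smul_right, hy, real_inner_comm] using
      congrArg (fun v => ⟪y, v⟫) h
  have h3 : a * ⟪x, z⟫ + b * ⟪y, z⟫ + c = 0 := by
    simpa [inner_add_right, inner_smul_right, hz, real_inner_comm] using
      congrArg (fun v => ⟪z, v⟫) h
  rw [sin_arccos, sin_arccos, ← sqrt_sq ha, ← sqrt_sq hc, ← sqrt_mul (sq_nonneg a),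
    ← sqrt_mul (sq_nonneg c)]
  congr 1
  linear_combination a * h1 - c * h3 - (a * ⟪x, y⟫ - c * ⟪y, z⟫) * h2

open Real in
theorem sin_arccos_inner_pos
    {E : Type*} [NormedAddCommGroup E] [InnerProductSpace ℝ E] {x y : E}
    (hx : ‖x‖ = 1) (hy : ‖y‖ = 1) (h : x ≠ y ∧ x ≠ -y) : 0 < sin (arccos ⟪x, y⟫) := by
  have hlt : ⟪x, y⟫ < 1 := (inner_lt_one_iff_real_of_norm_eq_one hx hy).2 h.1
  have hgt : ⟪x, -y⟫ < 1 := (inner_lt_one_iff_real_of_norm_eq_one hx (by rwa [norm_neg])).2 h.2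
  rw [inner_neg_right] at hgt
  rw [sin_arccos]
  exact sqrt_pos.2 (by nlinarith)

open Real in
/-- The weights of three balanced unit vectors in terms of the sines of their angles. -/
theorem weight_eq_of_balanced
    {E : Type*} [NormedAddCommGroup E] [InnerProductSpace ℝ E] {x y z : E}
    (hx : ‖x‖ = 1) (hy : ‖y‖ = 1) (hz : ‖z‖ = 1) (hyz : y ≠ z ∧ y ≠ -z)
    {a b c : ℝ} (ha : 0 < a) (hb : 0 < b) (hc : 0 < c)
    (h : a • x + b • y + c • z = 0) :
    a = (a + b + c) / (1 + sin (arccos ⟪x, z⟫) / sin (arccos ⟪y, z⟫)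
        + sin (arccos ⟪x, y⟫) / sin (arccos ⟪y, z⟫)) ∧
      a = (a + b + c) * sin (arccos ⟪y, z⟫) /
        (sin (arccos ⟪x, y⟫) + sin (arccos ⟪y, z⟫) + sin (arccos ⟪z, x⟫)) := by
  have h1 := mul_sin_arccos_inner_eq_of_balanced hx hy hz ha.le hc.le h
  have h2 := mul_sin_arccos_inner_eq_of_balanced hx hz hy ha.le hb.le
    (show a • x + c • z + b • y = 0 by rw [← h]; abel)
  have hs := sin_arccos_inner_pos hy hz hyz
  rw [real_inner_comm y z] at h2
  rw [real_inner_comm x z]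
  generalize sin (arccos ⟪y, z⟫) = s at *
  have e1 : sin (arccos ⟪x, y⟫) = c * s / a := by rw [← h1]; field_simp
  have e2 : sin (arccos ⟪x, z⟫) = b * s / a := by rw [← h2]; field_simp
  rw [e1, e2]
  constructor
  · rw [eq_div_iff (by positivity)]
    field_simp
  · rw [eq_div_iff (by positivity)]
    field_simp
    ring

/-- **Equation (2.2) of the paper's Lemma 3 (solution of the inverse weighted
Fermat–Torricelli problem)**: if pairwise non-parallel unit vectors `u 0, u 1, u 2`
satisfy the balancing condition with positive weights `b i` of total sum `C`, then,
writing `φ_{i0j} = arccos ⟪u i, u j⟫`, for every permutation `(i, j, k)`: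
`b i = C / (1 + sin φ_{i0k} / sin φ_{j0k} + sin φ_{i0j} / sin φ_{j0k})`, equivalently
`b i = C * sin φ_{j0k} / (sin φ₁₀₂ + sin φ₂₀₃ + sin φ₃₀₁)`. -/
theorem inverse_fermat_torricelli_weights
    {E : Type*} [NormedAddCommGroup E] [InnerProductSpace ℝ E]
    (u : Fin 3 → E) (hu : ∀ i, ‖u i‖ = 1)
    (hnp : ∀ i j : Fin 3, i ≠ j → u i ≠ u j ∧ u i ≠ -u j)
    (b : Fin 3 → ℝ) (hb : ∀ i, 0 < b i)
    (hbal : b 0 • u 0 + b 1 • u 1 + b 2 • u 2 = 0)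
    (C : ℝ) (hC : C = b 0 + b 1 + b 2) :
    ∀ i j k : Fin 3, i ≠ j → j ≠ k → k ≠ i →
      b i = C / (1 + Real.sin (Real.arccos ⟪u i, u k⟫) / Real.sin (Real.arccos ⟪u j, u k⟫)
              + Real.sin (Real.arccos ⟪u i, u j⟫) / Real.sin (Real.arccos ⟪u j, u k⟫)) ∧
      b i = C * Real.sin (Real.arccos ⟪u j, u k⟫) /
          (Real.sin (Real.arccos ⟪u 0, u 1⟫) + Real.sin (Real.arccos ⟪u 1, u 2⟫)
            + Real.sin (Real.arccos ⟪u 2, u 0⟫)) := by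
  intro i j k hij hjk hki
  have hsum : b i + b j + b k = C := by
    fin_cases i <;> fin_cases j <;> fin_cases k <;> first | contradiction | (dsimp; linarith)
  have hbal' : b i • u i + b j • u j + b k • u k = 0 := by
    rw [← hbal]
    fin_cases i <;> fin_cases j <;> fin_cases k <;>
      first | contradiction | rfl | (dsimp; abel)
  have hden : Real.sin (Real.arccos ⟪u 0, u 1⟫) + Real.sin (Real.arccos ⟪u 1, u 2⟫)
      + Real.sin (Real.arccos ⟪u 2, u 0⟫) = Real.sin (Real.arccos ⟪u i, u j⟫)
      + Real.sin (Real.arccos ⟪u j, u k⟫) + Real.sin (Real.arccos ⟪u k, u i⟫) := by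
    rw [real_inner_comm (u 0) (u 2)]
    fin_cases i <;> fin_cases j <;> fin_cases k <;> first
      | contradiction
      | (dsimp
         simp only [real_inner_comm (u 0) (u 1), real_inner_comm (u 0) (u 2),
           real_inner_comm (u 1) (u 2)]
         try ring)
  rw [hden, ← hsum]
  exact weight_eq_of_balanced (hu i) (hu j) (hu k) (hnp j k hjk) (hb i) (hb j) (hb k) hbal'
end

section
/- Let u₁, u₂, u₃ be unit vectors in the Euclidean plane EuclideanSpace ℝ (Fin 2) such that each pairwise angle φ_{i0j} := arccos⟨u_i, u_j⟩ lies in the open interval (0, π) and φ₁₀₂ + φ₂₀₃ + φ₃₀₁ = 2π. Define b_i := sin φ_{j0k}/(sin φ₁₀₂ + sin φ₂₀₃ + sin φ₃₀₁) for each permutation (i, j, k) of (1, 2, 3) with (j,k) the pair complementary to i. Then b₁, b₂, b₃ > 0, b₁ + b₂ + b₃ = 1, and b₁·u₁ + b₂·u₂ + b₃·u₃ = 0. -/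
open scoped RealInnerProductSpace

/-- Three unit vectors whose pairwise angles sum to a full turn are balanced by the sines of the
opposite angles. -/
theorem sin_smul_add_sin_smul_add_sin_smul_eq_zero {E : Type*} [NormedAddCommGroup E]
    [InnerProductSpace ℝ E] {x y z : E} (hx : ‖x‖ = 1) (hy : ‖y‖ = 1) (hz : ‖z‖ = 1) {α β γ : ℝ}
    (hxy : ⟪x, y⟫ = Real.cos α) (hyz : ⟪y, z⟫ = Real.cos β) (hzx : ⟪z, x⟫ = Real.cos γ)
    (hsum : α + β + γ = 2 * Real.pi) :
    Real.sin β • x + Real.sin γ • y + Real.sin α • z = 0 := by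
  have hγ : γ = 2 * Real.pi - (α + β) := by linarith
  have hsin : Real.sin γ = -(Real.sin α * Real.cos β + Real.cos α * Real.sin β) := by
    rw [hγ, Real.sin_two_pi_sub, Real.sin_add]
  have hcos : Real.cos γ = Real.cos α * Real.cos β - Real.sin α * Real.sin β := by
    rw [hγ, Real.cos_two_pi_sub, Real.cos_add]
  rw [← inner_self_eq_zero (𝕜 := ℝ)]
  simp only [inner_add_left, inner_add_right, real_inner_smul_left, real_inner_smul_right,
    real_inner_self_eq_norm_sq, norm_smul, mul_pow, Real.norm_eq_abs, sq_abs, hx, hy, hz,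
    real_inner_comm x y, real_inner_comm y z, real_inner_comm z x, hxy, hyz, hzx]
  rw [hsin, hcos]
  have hα := Real.sin_sq_add_cos_sq α
  have hβ := Real.sin_sq_add_cos_sq β
  grind

/-- **Existence part of the paper's Lemma 3 (inverse weighted Fermat–Torricelli
problem)** in the Euclidean plane: if the pairwise angles `φ_{i0j} = arccos ⟪u i, u j⟫`
of three unit vectors lie in `(0, π)` and sum to `2π`, then the normalized weights
`b i = sin φ_{j0k} / (sin φ₁₀₂ + sin φ₂₀₃ + sin φ₃₀₁)` are positive, sum to `1`, and
satisfy the balancing condition `b 0 • u 0 + b 1 • u 1 + b 2 • u 2 = 0`. -/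
theorem inverse_fermat_torricelli_existence
    (u : Fin 3 → EuclideanSpace ℝ (Fin 2)) (hu : ∀ i, ‖u i‖ = 1)
    (hang : ∀ i j : Fin 3, i ≠ j →
      Real.arccos ⟪u i, u j⟫ ∈ Set.Ioo 0 Real.pi)
    (hsum : Real.arccos ⟪u 0, u 1⟫ + Real.arccos ⟪u 1, u 2⟫ +
      Real.arccos ⟪u 2, u 0⟫ = 2 * Real.pi)
    (b : Fin 3 → ℝ)
    (hb0 : b 0 = Real.sin (Real.arccos ⟪u 1, u 2⟫) /
      (Real.sin (Real.arccos ⟪u 0, u 1⟫) + Real.sin (Real.arccos ⟪u 1, u 2⟫) +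
        Real.sin (Real.arccos ⟪u 2, u 0⟫)))
    (hb1 : b 1 = Real.sin (Real.arccos ⟪u 2, u 0⟫) /
      (Real.sin (Real.arccos ⟪u 0, u 1⟫) + Real.sin (Real.arccos ⟪u 1, u 2⟫) +
        Real.sin (Real.arccos ⟪u 2, u 0⟫)))
    (hb2 : b 2 = Real.sin (Real.arccos ⟪u 0, u 1⟫) /
      (Real.sin (Real.arccos ⟪u 0, u 1⟫) + Real.sin (Real.arccos ⟪u 1, u 2⟫) +
        Real.sin (Real.arccos ⟪u 2, u 0⟫))) :
    (∀ i, 0 < b i) ∧ b 0 + b 1 + b 2 = 1 ∧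
      b 0 • u 0 + b 1 • u 1 + b 2 • u 2 = 0 := by
  have h01 := Real.sin_pos_of_mem_Ioo (hang 0 1 (by decide))
  have h12 := Real.sin_pos_of_mem_Ioo (hang 1 2 (by decide))
  have h20 := Real.sin_pos_of_mem_Ioo (hang 2 0 (by decide))
  have hcos : ∀ i j, ⟪u i, u j⟫ = Real.cos (Real.arccos ⟪u i, u j⟫) := fun i j => by
    have h := abs_le.mp (abs_real_inner_le_norm (u i) (u j))
    rw [hu, hu, one_mul] at h
    exact (Real.cos_arccos h.1 h.2).symm
  have hbal := sin_smul_add_sin_smul_add_sin_smul_eq_zero (hu 0) (hu 1) (hu 2)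
    (hcos 0 1) (hcos 1 2) (hcos 2 0) hsum
  refine ⟨fun i => ?_, ?_, ?_⟩
  · fin_cases i
    · simp only [Fin.zero_eta, hb0]; positivity
    · simp only [Fin.mk_one, hb1]; positivity
    · simp only [Fin.reduceFinMk, hb2]; positivity
  · rw [hb0, hb1, hb2]
    field_simp
    ring
  · rw [hb0, hb1, hb2]
    simp only [div_eq_inv_mul, mul_smul]
    rw [← smul_add, ← smul_add, hbal, smul_zero]
end

section
/- Let u₁, u₂, u₃ be unit vectors in a real inner product space such that no two of them are parallel (u_i ≠ u_j and u_i ≠ −u_j for all i ≠ j). Suppose b₁, b₂, b₃ > 0 and b₁', b₂', b₃' > 0 satisfy b₁·u₁ + b₂·u₂ + b₃·u₃ = 0, b₁'·u₁ + b₂'·u₂ + b₃'·u₃ = 0, and b₁ + b₂ + b₃ = b₁' + b₂' + b₃'. Then b_i = b_i' for i = 1, 2, 3. -/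
/-- Two vectors of norm one that are neither equal nor opposite satisfy only the trivial
linear relation. -/
theorem eq_zero_of_smul_add_smul_eq_zero_of_norm_one
    {E : Type*} [NormedAddCommGroup E] [NormedSpace ℝ E] {x y : E}
    (hx : ‖x‖ = 1) (hy : ‖y‖ = 1) (hne : x ≠ y) (hne_neg : x ≠ -y)
    {p q : ℝ} (h : p • x + q • y = 0) : p = 0 ∧ q = 0 := by
  have habs : |p| = |q| := by
    have := congrArg norm (eq_neg_of_add_eq_zero_left h)
    simpa [norm_smul, hx, hy] using this
  rcases abs_eq_abs.mp habs with rfl | rfl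
  · rw [← smul_add, smul_eq_zero] at h
    have hp := h.resolve_right fun h => hne_neg (eq_neg_of_add_eq_zero_left h)
    exact ⟨hp, hp⟩
  · rw [neg_smul, neg_add_eq_zero, ← sub_eq_zero, ← smul_sub, smul_eq_zero] at h
    have hq := h.resolve_right fun h => hne (sub_eq_zero.mp h)
    exact ⟨by simp [hq], hq⟩

/-- **Uniqueness part of the paper's Lemma 3**: for pairwise non-parallel unit vectors
`u 0, u 1, u 2` in a real inner product space, two triples of positive weights
satisfying the balancing condition and having the same total sum must coincide. -/
theorem inverse_fermat_torricelli_uniqueness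
    {E : Type*} [NormedAddCommGroup E] [InnerProductSpace ℝ E]
    (u : Fin 3 → E) (hu : ∀ i, ‖u i‖ = 1)
    (hnp : ∀ i j : Fin 3, i ≠ j → u i ≠ u j ∧ u i ≠ -u j)
    (b b' : Fin 3 → ℝ) (hb : ∀ i, 0 < b i) (hb' : ∀ i, 0 < b' i)
    (hbal : b 0 • u 0 + b 1 • u 1 + b 2 • u 2 = 0)
    (hbal' : b' 0 • u 0 + b' 1 • u 1 + b' 2 • u 2 = 0)
    (hsum : b 0 + b 1 + b 2 = b' 0 + b' 1 + b' 2) :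
    ∀ i, b i = b' i := by
  have helim : (b 0 * b' 2 - b' 0 * b 2) • u 0 + (b 1 * b' 2 - b' 1 * b 2) • u 1 = 0 := by
    linear_combination (norm := module) b' 2 • hbal - b 2 • hbal'
  obtain ⟨hne, hne_neg⟩ := hnp 0 1 (by decide)
  obtain ⟨h₀, h₁⟩ :=
    eq_zero_of_smul_add_smul_eq_zero_of_norm_one (hu 0) (hu 1) hne hne_neg helim
  have hpos : b 0 + b 1 + b 2 ≠ 0 :=
    (add_pos (add_pos (hb 0) (hb 1)) (hb 2)).ne'
  have h₂ : b 2 = b' 2 := by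
    apply mul_left_cancel₀ hpos
    linear_combination b 2 * hsum - h₀ - h₁
  have hcancel : ∀ {s t : ℝ}, s * b' 2 - t * b 2 = 0 → s = t := fun h =>
    mul_right_cancel₀ (hb' 2).ne' (by rw [h₂] at h; exact sub_eq_zero.mp h)
  intro i
  fin_cases i
  · exact hcancel h₀
  · exact hcancel h₁
  · exact h₂
end

section
/- Let b₁, b₂, b₃ be positive real numbers satisfying the strict triangle inequalities, define w(x,y,z) := (x² + y² − z²)/(2xy), and set φ₁₀₂ := arccos(−w(b₁,b₂,b₃)). Let α₁ ∈ (π/2, π), set α₂ := α₁ + φ₁₀₂ − π, let ρ be a nonzero real number, and set c₁ := ρ·cos α₁ and c₂ := ρ·cos α₂. Then c₂ = c₁·(w(b₁,b₂,b₃) − |tan α₁|·√(1 − w(b₁,b₂,b₃)²)). -/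
/-- `w x y z = (x² + y² − z²) / (2 x y)`. -/
noncomputable def w (x y z : ℝ) : ℝ := (x ^ 2 + y ^ 2 - z ^ 2) / (2 * x * y)

/-- Under the strict triangle inequalities, `w x y z` is the cosine of a nondegenerate angle. -/
theorem w_mem_Ioo {x y z : ℝ} (hx : 0 < x) (hy : 0 < y)
    (h₁ : x < y + z) (h₂ : y < z + x) (h₃ : z < x + y) :
    w x y z ∈ Set.Ioo (-1) 1 := by
  have hxy : 0 < 2 * x * y := by positivity
  constructor
  · rw [w, lt_div_iff₀ hxy]
    nlinarith
  · rw [w, div_lt_iff₀ hxy]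
    nlinarith

/-- **Formula for `c₂` in the paper's Theorem 2.1**: with `φ₁₀₂ = arccos (−w b₁ b₂ b₃)`,
`α₂ = α₁ + φ₁₀₂ − π` (i.e. `φ₁₀₂ = π + α₂ − α₁`), and Clairaut constants
`c₁ = ρ cos α₁`, `c₂ = ρ cos α₂`, one has
`c₂ = c₁ * (w b₁ b₂ b₃ − |tan α₁| * √(1 − (w b₁ b₂ b₃)²))`. -/
theorem clairaut_constant_c2_formula
    (b₁ b₂ b₃ : ℝ) (hb₁ : 0 < b₁) (hb₂ : 0 < b₂) (hb₃ : 0 < b₃)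
    (h₁ : b₁ < b₂ + b₃) (h₂ : b₂ < b₃ + b₁) (h₃ : b₃ < b₁ + b₂)
    (φ₁₀₂ : ℝ) (hφ : φ₁₀₂ = Real.arccos (-(w b₁ b₂ b₃)))
    (α₁ : ℝ) (hα₁ : α₁ ∈ Set.Ioo (Real.pi / 2) Real.pi)
    (α₂ : ℝ) (hα₂ : α₂ = α₁ + φ₁₀₂ - Real.pi)
    (ρ : ℝ) (hρ : ρ ≠ 0)
    (c₁ c₂ : ℝ) (hc₁ : c₁ = ρ * Real.cos α₁) (hc₂ : c₂ = ρ * Real.cos α₂) :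
    c₂ = c₁ * (w b₁ b₂ b₃ - |Real.tan α₁| * Real.sqrt (1 - (w b₁ b₂ b₃) ^ 2)) := by
  have hw := w_mem_Ioo hb₁ hb₂ h₁ h₂ h₃
  have hcos : Real.cos α₁ < 0 :=
    Real.cos_neg_of_pi_div_two_lt_of_lt hα₁.1 (by linarith [hα₁.2, Real.pi_pos])
  have hsin : 0 < Real.sin α₁ :=
    Real.sin_pos_of_pos_of_lt_pi (by linarith [hα₁.1, Real.pi_pos]) hα₁.2
  have htan : Real.tan α₁ < 0 := by
    rw [Real.tan_eq_sin_div_cos]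
    exact div_neg_of_pos_of_neg hsin hcos
  rw [hc₂, hc₁, hα₂, hφ, Real.cos_sub_pi, Real.cos_add, Real.sin_arccos,
    Real.cos_arccos (by linarith [hw.2]) (by linarith [hw.1]), neg_sq, abs_of_neg htan,
    ← Real.tan_mul_cos hcos.ne]
  ring
end

section
/- Let b₁, b₂, b₃ be positive real numbers satisfying the strict triangle inequalities and additionally b₃² < b₁² + b₂², define w := (b₁² + b₂² − b₃²)/(2·b₁·b₂) and φ₁₀₂ := arccos(−w). Let α₁ ∈ (π/2, π), set α₂ := α₁ + φ₁₀₂ − π, and assume α₂ ∈ (π/2, π). Let ρ be a nonzero real number and set c₁ := ρ·cos α₁ and c₂ := ρ·cos α₂. Then 0 < c₂/c₁ and c₂/c₁ < w/(cos α₁)². -/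
/-- **Inequality (2.7) of the paper's Theorem 2.1**: with
`w = (b₁² + b₂² − b₃²) / (2 b₁ b₂) > 0` (i.e. `b₃² < b₁² + b₂²`),
`φ₁₀₂ = arccos (−w)`, `α₂ = α₁ + φ₁₀₂ − π`, `α₁, α₂ ∈ (π/2, π)`, and Clairaut
constants `c₁ = ρ cos α₁`, `c₂ = ρ cos α₂`, one has
`0 < c₂ / c₁ < w / cos² α₁`. -/
theorem clairaut_ratio_c2_c1_bounds
    (b₁ b₂ b₃ : ℝ) (hb₁ : 0 < b₁) (hb₂ : 0 < b₂) (hb₃ : 0 < b₃)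
    (h₁ : b₁ < b₂ + b₃) (h₂ : b₂ < b₃ + b₁) (h₃ : b₃ < b₁ + b₂)
    (hacute : b₃ ^ 2 < b₁ ^ 2 + b₂ ^ 2)
    (w : ℝ) (hw : w = (b₁ ^ 2 + b₂ ^ 2 - b₃ ^ 2) / (2 * b₁ * b₂))
    (φ₁₀₂ : ℝ) (hφ : φ₁₀₂ = Real.arccos (-w))
    (α₁ : ℝ) (hα₁ : α₁ ∈ Set.Ioo (Real.pi / 2) Real.pi)
    (α₂ : ℝ) (hα₂ : α₂ = α₁ + φ₁₀₂ - Real.pi)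
    (hα₂mem : α₂ ∈ Set.Ioo (Real.pi / 2) Real.pi)
    (ρ : ℝ) (hρ : ρ ≠ 0)
    (c₁ c₂ : ℝ) (hc₁ : c₁ = ρ * Real.cos α₁) (hc₂ : c₂ = ρ * Real.cos α₂) :
    0 < c₂ / c₁ ∧ c₂ / c₁ < w / (Real.cos α₁) ^ 2 := by
  have hbb : 0 < 2 * b₁ * b₂ := by positivity
  have hw_pos : 0 < w := by
    rw [hw]
    exact div_pos (by linarith) hbb
  have hw_le : w ≤ 1 := by
    rw [hw, div_le_one hbb]
    nlinarith [mul_pos (sub_pos.mpr h₁) (sub_pos.mpr h₂)]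
  have hcos_sub : Real.cos (α₁ - α₂) = w := by
    have hsub : α₁ - α₂ = Real.arccos w := by
      rw [hα₂, hφ, Real.arccos_neg]
      ring
    rw [hsub, Real.cos_arccos (by linarith) hw_le]
  obtain ⟨h₁l, h₁r⟩ := hα₁
  obtain ⟨h₂l, h₂r⟩ := hα₂mem
  have hcos₁ : Real.cos α₁ < 0 :=
    Real.cos_neg_of_pi_div_two_lt_of_lt h₁l (by linarith [Real.pi_pos])
  have hcos₂ : Real.cos α₂ < 0 :=
    Real.cos_neg_of_pi_div_two_lt_of_lt h₂l (by linarith [Real.pi_pos])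
  have hsin₁ : 0 < Real.sin α₁ := Real.sin_pos_of_pos_of_lt_pi (by linarith [Real.pi_pos]) h₁r
  have hsin₂ : 0 < Real.sin α₂ := Real.sin_pos_of_pos_of_lt_pi (by linarith [Real.pi_pos]) h₂r
  have hratio : c₂ / c₁ = Real.cos α₂ / Real.cos α₁ := by
    rw [hc₁, hc₂, mul_div_mul_left _ _ hρ]
  rw [hratio]
  refine ⟨div_pos_of_neg_of_neg hcos₂ hcos₁, ?_⟩
  rw [lt_div_iff₀ (sq_pos_of_neg hcos₁), ← hcos_sub, Real.cos_sub]
  have hmul : Real.cos α₂ / Real.cos α₁ * Real.cos α₁ ^ 2 = Real.cos α₁ * Real.cos α₂ := by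
    field_simp
  linarith [mul_pos hsin₁ hsin₂]
end
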